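/- arXiv:1602.02576 — 2 statements merged into one kernel-verified Lean document; each statement's English description precedes it below -/
import Mathlib

section
/- Let d ≥ 3 be an odd integer and k ≥ 1 an integer. Then the polynomials φ_{2^k+1}(x,y,z) and φ_d(x,y,z) are relatively prime (have no nonconstant common factor) over the algebraic closure of F_2, except when d = 2^l+1 for some integer l with gcd(l,k) > 1. -/
open MvPolynomial

/-- The numerator `x^j + y^j + z^j + (x+y+z)^j` of `φ_j`, as an element of `L[x,y,z]`. -/
noncomputable def phiJNum (L : Type) [CommRing L] (j : ℕ) : MvPolynomial (Fin 3) L :=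
  X 0 ^ j + X 1 ^ j + X 2 ^ j + (X 0 + X 1 + X 2) ^ j

section Choose

theorem choose_two_mul_two_mul_modEq (a b : ℕ) :
    (2 * a).choose (2 * b) ≡ a.choose b [MOD 2] := by
  have := Choose.choose_modEq_choose_mod_mul_choose_div_nat (n := 2 * a) (k := 2 * b) (p := 2)
  simpa using this

theorem choose_two_pow_mul_two_pow_modEq (s m : ℕ) :
    (2 ^ s * m).choose (2 ^ s) ≡ m [MOD 2] := by
  induction s with
  | zero => simp [Nat.ModEq.refl]
  | succ s ih =>
    rw [pow_succ', mul_assoc]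
    exact (choose_two_mul_two_mul_modEq _ _).trans ih

theorem odd_choose_of_modEq {n r m : ℕ} (hm : Odd m) (h : n.choose r ≡ m [MOD 2]) :
    Odd (n.choose r) := by
  rw [Nat.odd_iff] at *
  rw [← hm]
  exact h

theorem odd_choose_succ_two_pow {s m : ℕ} (hs : s ≠ 0) (hm : Odd m) :
    Odd ((2 ^ s * m + 1).choose (2 ^ s)) := by
  obtain ⟨s, rfl⟩ := Nat.exists_eq_succ_of_ne_zero hs
  refine odd_choose_of_modEq hm (Nat.ModEq.trans ?_ (choose_two_pow_mul_two_pow_modEq s m))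
  have := Choose.choose_modEq_choose_mod_mul_choose_div_nat
    (n := 2 * (2 ^ s * m) + 1) (k := 2 * 2 ^ s) (p := 2)
  rw [Nat.succ_eq_add_one, pow_succ', mul_assoc]
  simpa [Nat.mul_add_mod, Nat.mul_add_div] using this

theorem odd_choose_succ_two_pow_succ {s m : ℕ} (hs : s ≠ 0) (hm : Odd m) :
    Odd ((2 ^ s * m + 1).choose (2 ^ s + 1)) := by
  obtain ⟨s, rfl⟩ := Nat.exists_eq_succ_of_ne_zero hs
  refine odd_choose_of_modEq hm (Nat.ModEq.trans ?_ (choose_two_pow_mul_two_pow_modEq s m))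
  have := Choose.choose_modEq_choose_mod_mul_choose_div_nat
    (n := 2 * (2 ^ s * m) + 1) (k := 2 * 2 ^ s + 1) (p := 2)
  rw [Nat.succ_eq_add_one, pow_succ', mul_assoc]
  simpa [Nat.mul_add_mod, Nat.mul_add_div] using this

end Choose

section CharTwo

variable {K : Type*} [Field K] [CharP K 2]

theorem pow_sub_eq_of_add_eq_one {x y : K} {n r : ℕ} (hxy : x + y = 1)
    (hr : ∃ s, r = 2 ^ s) (hrn : r ≤ n) (hn : x ^ n + y ^ n = 1)
    (hnr : x ^ (n - r) + y ^ (n - r) = 1) : y ^ (n - r) = y ^ r := by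
  obtain ⟨s, rfl⟩ := hr
  obtain ⟨m, rfl⟩ := Nat.exists_eq_add_of_le hrn
  rw [Nat.add_sub_cancel_left] at *
  have hs : x ^ 2 ^ s + y ^ 2 ^ s = 1 := by rw [← add_pow_char_pow, hxy, one_pow]
  rw [pow_add, pow_add] at hn
  linear_combination (-x ^ 2 ^ s) * hnr + hn + (1 - y ^ m) * hs +
    (x ^ 2 ^ s * y ^ m - x ^ 2 ^ s - y ^ 2 ^ s + 1) * CharTwo.two_eq_zero (R := K)

theorem sq_eq_self_of_gcd_eq_one {x : K} {k l : ℕ} (hgcd : Nat.gcd l k = 1)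
    (hk : x ^ 2 ^ k = x) (hl : x ^ 2 ^ l = x) : x ^ 2 = x := by
  have key (n : ℕ) (h : x ^ 2 ^ n = x) : Function.IsPeriodicPt (frobenius K 2) n x := by
    rw [Function.IsPeriodicPt, Function.IsFixedPt, iterate_frobenius, h]
  have := (key l hl).gcd (key k hk)
  rw [hgcd, Function.IsPeriodicPt, Function.IsFixedPt, iterate_frobenius] at this
  simpa using this

theorem pow_add_pow_eq_one {x y : K} {d i : ℕ}
    (h : (Polynomial.X + Polynomial.C x) ^ d + (Polynomial.X + Polynomial.C y) ^ d +
      (Polynomial.X + Polynomial.C 1) ^ d + Polynomial.X ^ d = 0)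
    (hid : i < d) (hodd : Odd (d.choose i)) : x ^ (d - i) + y ^ (d - i) = 1 := by
  have h1 := congrArg (Polynomial.coeff · i) h
  have hc : ((d.choose i : ℕ) : K) = 1 := by
    obtain ⟨c, hc⟩ := hodd
    rw [hc]
    simp [CharTwo.two_eq_zero]
  simp only [Polynomial.coeff_add, Polynomial.coeff_X_add_C_pow, Polynomial.coeff_X_pow, hc,
    Polynomial.coeff_zero, hid.ne, if_false, one_pow, mul_one, add_zero] at h1
  exact CharTwo.add_eq_zero.mp h1

theorem sq_eq_self_of_polynomial_eq_zero {x y : K} {d k : ℕ} (hxy : x + y = 1)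
    (hd3 : 3 ≤ d) (hd_odd : Odd d) (hk : 1 ≤ k)
    (hexc : ¬ ∃ l : ℕ, d = 2 ^ l + 1 ∧ 1 < Nat.gcd l k) (hxk : x ^ 2 ^ k = x)
    (h : (Polynomial.X + Polynomial.C x) ^ d + (Polynomial.X + Polynomial.C y) ^ d +
      (Polynomial.X + Polynomial.C 1) ^ d + Polynomial.X ^ d = 0) : x ^ 2 = x := by
  by_cases hx : x = 0
  · simp [hx]
  by_cases hy : y = 0
  · rw [hy, add_zero] at hxy
    simp [hxy]
  have hyx : y + x = 1 := by rw [add_comm, hxy]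
  have h0 : x ^ d + y ^ d = 1 := by simpa using pow_add_pow_eq_one h (i := 0) (by omega) (by simp)
  have h1 := pow_add_pow_eq_one h (i := 1) (by omega) (by simpa using hd_odd)
  have hx1 : x ^ (d - 1) = x := by
    simpa using pow_sub_eq_of_add_eq_one (r := 1) hyx ⟨0, rfl⟩ (by omega)
      (by rw [add_comm, h0]) (by rw [add_comm, h1])
  have hy1 : y ^ (d - 1) = y := by
    simpa using pow_sub_eq_of_add_eq_one (r := 1) hxy ⟨0, rfl⟩ (by omega) h0 h1
  obtain ⟨s, m, hm, hdm⟩ := Nat.exists_eq_two_pow_mul_odd (n := d - 1) (by omega)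
  have hd : d = 2 ^ s * m + 1 := by omega
  have hs : s ≠ 0 := by
    rintro rfl
    rw [hd] at hd_odd
    simp only [pow_zero, one_mul] at hd_odd
    exact absurd hm.add_one (Nat.not_even_iff_odd.mpr hd_odd)
  obtain rfl | hm1 := eq_or_ne m 1
  · rw [mul_one] at hdm hd
    refine sq_eq_self_of_gcd_eq_one (l := s) (k := k) ?_ hxk (hdm ▸ hx1)
    have := Nat.gcd_pos_of_pos_right s hk
    by_contra hne
    exact hexc ⟨s, hd, by omega⟩
  · exfalso
    have hlt : 2 ^ s + 1 < d := by
      have h3 : 2 ≤ m := by have := hm.pos; omega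
      have := Nat.mul_le_mul_left (2 ^ s) h3
      have := Nat.one_lt_two_pow hs
      omega
    have hq := pow_add_pow_eq_one h (i := 2 ^ s) (by omega) (hd ▸ odd_choose_succ_two_pow hs hm)
    have hq1 := pow_add_pow_eq_one h (i := 2 ^ s + 1) hlt
      (hd ▸ odd_choose_succ_two_pow_succ hs hm)
    have aux {z : K} (hz : z ≠ 0) (hz1 : z ^ (d - 1) = z) (hzq : z ^ (d - 2 ^ s) = z ^ 2 ^ s) :
        z ^ (d - (2 ^ s + 1)) = 1 := by
      have e1 : z ^ d = z ^ 2 := by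
        rw [← Nat.sub_add_cancel (show 1 ≤ d by omega), pow_succ, hz1, sq]
      have e2 : z ^ d = (z ^ 2 ^ s) ^ 2 := by
        conv_lhs => rw [← Nat.sub_add_cancel (show 2 ^ s ≤ d by omega), pow_add, hzq, ← sq]
      have e3 : z ^ 2 ^ s = z := frobenius_inj K 2 (e2.symm.trans e1)
      have e4 : z ^ (d - (2 ^ s + 1)) * z ^ 2 ^ s = z := by
        rw [← pow_add, ← hz1]
        congr 1
        omega
      rw [e3] at e4
      exact mul_right_cancel₀ hz (by rw [e4, one_mul])
    rw [aux hx hx1 (pow_sub_eq_of_add_eq_one hyx ⟨s, rfl⟩ (by omega)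
        (by rw [add_comm, h0]) (by rw [add_comm, hq])),
      aux hy hy1 (pow_sub_eq_of_add_eq_one hxy ⟨s, rfl⟩ (by omega) h0 hq),
      CharTwo.add_self_eq_zero] at hq1
    exact zero_ne_one hq1

end CharTwo

theorem MvPolynomial.irreducible_of_isHomogeneous_one {σ K : Type*} [Field K]
    {p : MvPolynomial σ K} (hp : p.IsHomogeneous 1) (hp0 : p ≠ 0) : Irreducible p := by
  refine irreducible_of_totalDegree_eq_one (hp.totalDegree hp0) fun x hx ↦ ?_
  rw [isUnit_iff_ne_zero]
  rintro rfl
  exact hp0 (MvPolynomial.ext _ _ fun i ↦ by simpa using hx i)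

theorem dvd_or_dvd_of_prime_dvd_homogeneous {K R : Type*} [Field K] [IsAlgClosed K] [CommRing R]
    [Algebra K R] {p a b : R} (hp : Prime p) {n : ℕ} (hn : 2 ≤ n)
    (h : p ∣ a * b ^ n - a ^ n * b) :
    p ∣ b ∨ ∃ c : K, c ^ n = c ∧ p ∣ a - algebraMap K R c * b := by
  by_cases hb : p ∣ b
  · exact .inl hb
  right
  have : (Ideal.span {p}).IsPrime := (Ideal.span_singleton_prime hp.ne_zero).mpr hp
  let S := R ⧸ Ideal.span {p}
  let F := FractionRing S
  let f : R →+* F := (algebraMap S F).comp (Ideal.Quotient.mk _)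
  have hf (r : R) : f r = 0 ↔ p ∣ r := by
    rw [RingHom.comp_apply, IsFractionRing.to_map_eq_zero_iff, Ideal.Quotient.eq_zero_iff_mem,
      Ideal.mem_span_singleton]
  have hfb : f b ≠ 0 := by rwa [Ne, hf]
  have hab : f a * f b ^ n - f a ^ n * f b = 0 := by
    simpa using (hf _).mpr h
  let i : K →+* F := f.comp (algebraMap K R)
  have hroot : (f a / f b) ^ n = f a / f b := by
    rw [div_pow, div_eq_div_iff (pow_ne_zero _ hfb) hfb]
    linear_combination -hab
  have hne : (Polynomial.X ^ n - Polynomial.X : Polynomial K) ≠ 0 :=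
    FiniteField.X_pow_card_sub_X_ne_zero K (by omega)
  obtain ⟨c, hc⟩ := (IsAlgClosed.splits
    (Polynomial.X ^ n - Polynomial.X : Polynomial K)).mem_range_of_isRoot hne (i := i)
    (x := f a / f b) (by simp [Polynomial.IsRoot, hroot])
  refine ⟨c, i.injective (by rw [map_pow, hc, hroot]), ?_⟩
  rw [← hf, map_sub, map_mul]
  change f a - i c * f b = 0
  rw [hc, div_mul_cancel₀ _ hfb, sub_self]

section Phi

variable {K : Type} [Field K] [CharP K 2]

theorem phiJNum_two_pow_add_one (k : ℕ) :
    phiJNum K (2 ^ k + 1) =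
      (X 0 + X 2) * (X 1 + X 2) ^ 2 ^ k - (X 0 + X 2) ^ 2 ^ k * (X 1 + X 2) := by
  have h2 : (2 : MvPolynomial (Fin 3) K) = 0 := CharTwo.two_eq_zero
  simp only [phiJNum, pow_succ _ (2 ^ k), add_pow_char_pow]
  linear_combination (X 0 ^ 2 ^ k * (X 0 + X 1 + X 2) + X 1 ^ 2 ^ k * X 1 +
    X 2 ^ 2 ^ k * X 2 + X 2 ^ 2 ^ k * X 1) * h2

theorem eval_zero_eq_one {k : ℕ} (hk : 1 ≤ k) {g : Polynomial K}
    (h : (1 + Polynomial.X) * Polynomial.X * g =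
      1 + Polynomial.X ^ (2 ^ k + 1) + (1 + Polynomial.X) ^ (2 ^ k + 1)) : g.eval 0 = 1 := by
  have h2 : (2 : Polynomial K) = 0 := CharTwo.two_eq_zero
  obtain ⟨k, rfl⟩ := Nat.exists_eq_add_of_le' hk
  have hk1 : 1 < 2 ^ (k + 1) := Nat.one_lt_two_pow (by omega)
  obtain ⟨r, hr⟩ := Nat.exists_eq_add_of_le' hk1
  have hg : (1 + Polynomial.X) * g = 1 + Polynomial.X ^ (r + 1) := by
    refine mul_left_cancel₀ Polynomial.X_ne_zero ?_
    simp only [pow_succ _ (2 ^ (k + 1)), add_pow_char_pow, one_pow] at h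
    rw [hr] at h
    linear_combination h + (1 + Polynomial.X ^ (r + 3)) * h2
  simpa using congrArg (Polynomial.eval 0) hg

theorem eval_single_eq_one {k : ℕ} (hk : 1 ≤ k) {G : MvPolynomial (Fin 3) K}
    (hG : (X 0 + X 1) * (X 0 + X 2) * (X 1 + X 2) * G = phiJNum K (2 ^ k + 1)) :
    eval ![1, 0, 0] G = 1 ∧ eval ![0, 1, 0] G = 1 ∧ eval ![0, 0, 1] G = 1 := by
  have hcomp (v : Fin 3 → Polynomial K) :
      (aeval v G).eval 0 = eval (fun i ↦ (v i).eval 0) G := by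
    rw [aeval_def, polynomial_eval_eval₂]
    congr 2
    ext
    simp
  have key (v : Fin 3 → Polynomial K) := congrArg (aeval v) hG
  simp only [phiJNum, map_mul, map_add, map_pow, aeval_X] at key
  refine ⟨?_, ?_, ?_⟩
  · have := hcomp ![1, Polynomial.X, 0]
    rw [eval_zero_eq_one hk] at this
    · refine Eq.trans ?_ this.symm; congr 2; ext i; fin_cases i <;> simp
    · have := key ![1, Polynomial.X, 0]
      simp at this
      linear_combination this
  · have := hcomp ![0, 1, Polynomial.X]
    rw [eval_zero_eq_one hk] at this
    · refine Eq.trans ?_ this.symm; congr 2; ext i; fin_cases i <;> simp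
    · have := key ![0, 1, Polynomial.X]
      simp at this
      linear_combination this
  · have := hcomp ![Polynomial.X, 0, 1]
    rw [eval_zero_eq_one hk] at this
    · refine Eq.trans ?_ this.symm; congr 2; ext i; fin_cases i <;> simp
    · have := key ![Polynomial.X, 0, 1]
      simp at this
      rw [add_comm (1 : Polynomial K) Polynomial.X]
      linear_combination this

theorem sq_eq_self_of_dvd_phiJNum {d k : ℕ} {c : K}
    (hd3 : 3 ≤ d) (hd_odd : Odd d) (hk : 1 ≤ k)
    (hexc : ¬ ∃ l : ℕ, d = 2 ^ l + 1 ∧ 1 < Nat.gcd l k) (hck : c ^ 2 ^ k = c)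
    (h : X 0 + X 2 - C c * (X 1 + X 2) ∣ phiJNum K d) : c ^ 2 = c := by
  have h2 : (2 : Polynomial K) = 0 := CharTwo.two_eq_zero
  have h1 := map_dvd (aeval ![Polynomial.X + Polynomial.C c, Polynomial.X + Polynomial.C 1,
    (Polynomial.X : Polynomial K)]) h
  refine sq_eq_self_of_polynomial_eq_zero (y := c + 1) ?_ hd3 hd_odd hk hexc hck ?_
  · rw [← add_assoc, CharTwo.add_self_eq_zero, zero_add]
  · have h3 : (Polynomial.X + Polynomial.C c + Polynomial.X -
        Polynomial.C c * (Polynomial.X + 1 + Polynomial.X) : Polynomial K) = 0 := by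
      linear_combination (Polynomial.X - Polynomial.C c * Polynomial.X) * h2
    simp only [phiJNum, map_sub, map_mul, map_add, map_pow, aeval_X, aeval_C] at h1
    simp [h3] at h1
    have h4 : (Polynomial.X + Polynomial.C c + (Polynomial.X + 1) + Polynomial.X : Polynomial K) =
        Polynomial.X + (Polynomial.C c + 1) := by
      linear_combination Polynomial.X * h2
    rw [h4] at h1
    simp only [map_add, Polynomial.C_1]
    linear_combination h1

theorem isRelPrime_of_mul_eq_phiJNum [IsAlgClosed K] {d k : ℕ}
    (hd3 : 3 ≤ d) (hd_odd : Odd d) (hk : 1 ≤ k)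
    (hexc : ¬ ∃ l : ℕ, d = 2 ^ l + 1 ∧ 1 < Nat.gcd l k) {G D : MvPolynomial (Fin 3) K}
    (hG : (X 0 + X 1) * (X 0 + X 2) * (X 1 + X 2) * G = phiJNum K (2 ^ k + 1))
    (hD : (X 0 + X 1) * (X 0 + X 2) * (X 1 + X 2) * D = phiJNum K d) :
    IsRelPrime G D := by
  obtain ⟨hx, hy, hz⟩ := eval_single_eq_one hk hG
  refine WfDvdMonoid.isRelPrime_of_no_irreducible_factors ?_ fun p hp hpG hpD ↦ ?_
  · rintro ⟨rfl, -⟩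
    simp at hx
  have hlin {l : MvPolynomial (Fin 3) K} (hl : l.IsHomogeneous 1) (hl0 : l ≠ 0) (hpl : p ∣ l) :
      l ∣ G ∧ l ∣ D := by
    have hlp := (hp.associated_of_dvd (irreducible_of_isHomogeneous_one hl hl0) hpl).symm.dvd
    exact ⟨hlp.trans hpG, hlp.trans hpD⟩
  have hne {l : MvPolynomial (Fin 3) K} (v : Fin 3 → K) (hv : eval v G = 1) (hl : l ∣ G) :
      eval v l ≠ 0 := by
    intro h
    have := map_dvd (eval v) hl
    rw [h, hv] at this
    simp at this
  have hpN := hpG.mul_left ((X 0 + X 1) * (X 0 + X 2) * (X 1 + X 2))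
  rw [hG, phiJNum_two_pow_add_one] at hpN
  obtain hb | ⟨c, hck, hc⟩ := dvd_or_dvd_of_prime_dvd_homogeneous (K := K) hp.prime
    (Nat.one_lt_two_pow (by omega)) hpN
  · refine hne _ hx (hlin ((isHomogeneous_X _ _).add (isHomogeneous_X _ _)) ?_ hb).1 (by simp)
    intro h
    simpa using congrArg (eval ![0, 1, 0]) h
  · rw [algebraMap_eq] at hc
    have hcdvd := hlin (((isHomogeneous_X _ _).add (isHomogeneous_X _ _)).sub
      (by simpa using (isHomogeneous_C _ c).mul ((isHomogeneous_X _ _).add (isHomogeneous_X _ _))))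
      (fun h ↦ by simpa using congrArg (eval ![1, 0, 0]) h) hc
    have hsq := sq_eq_self_of_dvd_phiJNum hd3 hd_odd hk hexc hck
      (hD ▸ hcdvd.2.mul_left _)
    have : c * (c - 1) = 0 := by linear_combination hsq
    obtain rfl | hc1 := mul_eq_zero.mp this
    · exact hne _ hy hcdvd.1 (by simp)
    · rw [sub_eq_zero] at hc1
      subst hc1
      exact hne _ hz hcdvd.1 (by simp)

end Phi

/-- For `d ≥ 3` odd and `k ≥ 1`, the polynomials `φ_{2^k+1}` and `φ_d`
are relatively prime over the algebraic closure of `F₂`, except when `d = 2^l + 1`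
with `gcd(l, k) > 1`. -/
theorem phi_gold_phi_d_relPrime (d k : ℕ) (hd3 : 3 ≤ d) (hd_odd : Odd d) (hk : 1 ≤ k)
    (hexc : ¬ ∃ l : ℕ, d = 2 ^ l + 1 ∧ 1 < Nat.gcd l k)
    (φG : MvPolynomial (Fin 3) (ZMod 2))
    (hφG : (X 0 + X 1) * (X 0 + X 2) * (X 1 + X 2) * φG = phiJNum (ZMod 2) (2 ^ k + 1))
    (φd : MvPolynomial (Fin 3) (ZMod 2))
    (hφd : (X 0 + X 1) * (X 0 + X 2) * (X 1 + X 2) * φd = phiJNum (ZMod 2) d) :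
    IsRelPrime
      (MvPolynomial.map (algebraMap (ZMod 2) (AlgebraicClosure (ZMod 2))) φG)
      (MvPolynomial.map (algebraMap (ZMod 2) (AlgebraicClosure (ZMod 2))) φd) := by
  have : CharP (AlgebraicClosure (ZMod 2)) 2 := charP_of_injective_algebraMap' (ZMod 2) 2
  have key {j : ℕ} {φ : MvPolynomial (Fin 3) (ZMod 2)}
      (h : (X 0 + X 1) * (X 0 + X 2) * (X 1 + X 2) * φ = phiJNum (ZMod 2) j) :=
    congrArg (MvPolynomial.map (algebraMap (ZMod 2) (AlgebraicClosure (ZMod 2)))) h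
  simp only [phiJNum, map_mul, map_add, map_pow, map_X] at key
  exact isRelPrime_of_mul_eq_phiJNum hd3 hd_odd hk hexc (key hφG) (key hφd)
end

section
/- For every integer k ≥ 1, in the polynomial ring F_{2^k}[x,y,z] one has the factorization φ_{2^k+1}(x,y,z) = ∏_{α ∈ F_{2^k} \ F_2} (x + αy + (α+1)z); equivalently, (x+y)(x+z)(y+z) · ∏_{α ∈ F_{2^k} \ F_2} (x + αy + (α+1)z) = x^{2^k+1} + y^{2^k+1} + z^{2^k+1} + (x+y+z)^{2^k+1}, where the product runs over all α ∈ F_{2^k} with α ≠ 0 and α ≠ 1. -/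
open MvPolynomial

theorem prod_univ_X_sub_C_eq_X_pow_card_sub_X (K : Type*) [Field K] [Fintype K] :
    ∏ α : K, (Polynomial.X - Polynomial.C α) =
      Polynomial.X ^ Fintype.card K - Polynomial.X := by
  have hroots := FiniteField.roots_X_pow_card_sub_X K
  have h := Polynomial.prod_multiset_X_sub_C_of_monic_of_roots_card_eq
    (p := (Polynomial.X ^ Fintype.card K - Polynomial.X : Polynomial K))
    (Polynomial.monic_X_pow_sub (by
      rw [Polynomial.degree_X]; exact_mod_cast Fintype.one_lt_card))
    (by rw [hroots, FiniteField.X_pow_card_sub_X_natDegree_eq K Fintype.one_lt_card]; rfl)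
  rwa [hroots] at h

/-- The homogeneous form of `∏ (X - α) = X ^ q - X`, evaluated in an extension field of the
finite field with `q` elements. -/
theorem mul_prod_sub_algebraMap_mul_of_field {K L : Type*} [Field K] [Fintype K] [Field L]
    [Algebra K L] (u v : L) :
    v * ∏ α : K, (u - algebraMap K L α * v) =
      u ^ Fintype.card K * v - u * v ^ Fintype.card K := by
  rcases eq_or_ne v 0 with rfl | hv
  · simp [Fintype.card_ne_zero]
  have h := congrArg (Polynomial.aeval (u / v)) (prod_univ_X_sub_C_eq_X_pow_card_sub_X K)
  simp only [map_prod, map_sub, map_pow, Polynomial.aeval_X, Polynomial.aeval_C] at h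
  have hterm (α : K) : u - algebraMap K L α * v = v * (u / v - algebraMap K L α) := by
    field_simp
  simp only [hterm, Finset.prod_mul_distrib, h, Finset.prod_const, Finset.card_univ, div_pow]
  field_simp

/-- The homogeneous form of `∏ (X - α) = X ^ q - X`, evaluated in a domain over the finite field
with `q` elements. -/
theorem mul_prod_sub_algebraMap_mul {K R : Type*} [Field K] [Fintype K] [CommRing R] [IsDomain R]
    [Algebra K R] (u v : R) :
    v * ∏ α : K, (u - algebraMap K R α * v) =
      u ^ Fintype.card K * v - u * v ^ Fintype.card K := by
  apply IsFractionRing.injective R (FractionRing R)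
  simpa [map_prod, ← IsScalarTower.algebraMap_apply] using
    mul_prod_sub_algebraMap_mul_of_field (K := K) (algebraMap R (FractionRing R) u)
      (algebraMap R (FractionRing R) v)

/-- For `k ≥ 1`, in `F_{2^k}[x,y,z]` one has the factorization
`(x+y)(x+z)(y+z) · ∏_{α ∈ F_{2^k} \ F₂} (x + αy + (α+1)z)
  = x^{2^k+1} + y^{2^k+1} + z^{2^k+1} + (x+y+z)^{2^k+1}`,
the product running over all `α ∈ F_{2^k}` with `α ≠ 0` and `α ≠ 1`. -/
theorem phi_gold_factorization (k : ℕ) (hk : 1 ≤ k) (K : Type) [Field K] [Fintype K]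
    [DecidableEq K] (hcard : Fintype.card K = 2 ^ k) :
    (X 0 + X 1) * (X 0 + X 2) * (X 1 + X 2) *
        ∏ α ∈ Finset.univ.filter (fun α : K => α ≠ 0 ∧ α ≠ 1),
          (X 0 + C α * X 1 + C (α + 1) * X 2) =
      X 0 ^ (2 ^ k + 1) + X 1 ^ (2 ^ k + 1) + X 2 ^ (2 ^ k + 1) +
        (X 0 + X 1 + X 2) ^ (2 ^ k + 1) := by
  have : Fact (Nat.Prime 2) := ⟨Nat.prime_two⟩
  have : CharP K 2 := charP_of_card_eq_prime_pow hcard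
  have two : (2 : MvPolynomial ℕ K) = 0 := CharTwo.two_eq_zero
  have hf : Finset.univ.filter (fun α : K => α ≠ 0 ∧ α ≠ 1) =
      (Finset.univ.erase 0).erase 1 := by
    ext; simp [and_comm]
  have key := mul_prod_sub_algebraMap_mul (K := K) (X 0 + X 2 : MvPolynomial ℕ K) (X 1 + X 2)
  rw [hcard, ← Finset.mul_prod_erase _ _ (Finset.mem_univ (0 : K)),
    ← Finset.mul_prod_erase _ _ (by simp : (1 : K) ∈ Finset.univ.erase 0), ← hf,
    add_pow_char_pow, add_pow_char_pow] at key
  have hp : ∀ α : K, (X 0 + C α * X 1 + C (α + 1) * X 2 : MvPolynomial ℕ K) =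
      X 0 + X 2 - algebraMap K (MvPolynomial ℕ K) α * (X 1 + X 2) := fun α => by
    rw [CharTwo.sub_eq_add, MvPolynomial.algebraMap_eq, C_add, C_1]
    ring
  simp only [hp]
  set P := ∏ α ∈ Finset.univ.filter (fun α : K => α ≠ 0 ∧ α ≠ 1),
    (X 0 + X 2 - algebraMap K (MvPolynomial ℕ K) α * (X 1 + X 2))
  rw [pow_succ (X 0 + X 1 + X 2), add_pow_char_pow, add_pow_char_pow]
  simp only [map_zero, map_one, CharTwo.sub_eq_add] at key ⊢
  linear_combination key - (X 0 * X 0 ^ 2 ^ k + X 1 * X 1 ^ 2 ^ k +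
    P * X 2 * (X 0 + X 2) * (X 1 + X 2)) * two
end
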